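/- Let x ∈ ℝ with x ≥ 0 and set k := ⌈x⌉ + 1. If the real symmetric matrix A^Q(x), indexed by the perfect matchings on Fin (6k) and with entries A^Q(x)_{M,N} = ∑_{q ∈ Q} x^{c(M, q·N)}, is positive semidefinite, then x = k − 1; in particular x is a nonnegative integer. -/

import Mathlib

/-- A perfect matching on `Fin (6*k)`: a fixed-point-free involution. -/
def IsPM {m : ℕ} (M : Equiv.Perm (Fin m)) : Prop :=
  M * M = 1 ∧ ∀ a, M a ≠ a

/-- `numOrbits M N` is the number of orbits on `Fin m` of the subgroup of
`Equiv.Perm (Fin m)` generated by `{M, N}`. -/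
noncomputable def numOrbits {m : ℕ} (M N : Equiv.Perm (Fin m)) : ℕ :=
  Nat.card (MulAction.orbitRel.Quotient (Subgroup.closure {M, N}) (Fin m))

noncomputable instance (m : ℕ) : Fintype {M : Equiv.Perm (Fin m) // IsPM M} :=
  Fintype.ofFinite _

/-- The `i`-th element (for `i : Fin 3`) of the `j`-th block (for `j : Fin (2*k)`);
in 1-indexed labels this is the element `3*j - (2 - i)` of the block `{3j-2, 3j-1, 3j}`. -/
def blk {k : ℕ} (j : Fin (2 * k)) (i : Fin 3) : Fin (6 * k) :=
  ⟨3 * j.val + i.val, by have := j.isLt; have := i.isLt; omega⟩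

/-- The group `B = B₁B₂⋯B_{2k}`, where `B_j` is the cyclic group generated by the
3-cycle `(3j-2, 3j-1, 3j)`: on each block, `b` acts as a cyclic rotation. -/
def Bset (k : ℕ) : Set (Equiv.Perm (Fin (6 * k))) :=
  {b | ∀ j : Fin (2 * k), ∃ s : Fin 3, ∀ i : Fin 3, b (blk j i) = blk j (i + s)}

/-- The group `D` of permutations permuting the blocks while preserving positions
inside each block. -/
def Dset (k : ℕ) : Set (Equiv.Perm (Fin (6 * k))) :=
  {d | ∃ π : Equiv.Perm (Fin (2 * k)), ∀ (j : Fin (2 * k)) (i : Fin 3), d (blk j i) = blk (π j) i}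

/-- The group `Q = BD`. -/
def Qset (k : ℕ) : Set (Equiv.Perm (Fin (6 * k))) :=
  {q | ∃ b ∈ Bset k, ∃ d ∈ Dset k, q = b * d}

noncomputable def Qfin (k : ℕ) : Finset (Equiv.Perm (Fin (6 * k))) :=
  (Set.toFinite (Qset k)).toFinset

/-- The matrix `A^Q(x)`, indexed by the perfect matchings on `Fin (6*k)`, with entries
`A^Q(x)_{M,N} = ∑_{q ∈ Q} x ^ c(M, q·N)` where `q · N = q N q⁻¹`. -/
noncomputable def AQ (k : ℕ) (x : ℝ) :
    Matrix {M : Equiv.Perm (Fin (6 * k)) // IsPM M} {M : Equiv.Perm (Fin (6 * k)) // IsPM M} ℝ :=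
  Matrix.of fun M N => ∑ q ∈ Qfin k, x ^ numOrbits M.1 (q * N.1 * q⁻¹)

/-- `μ(x) = ∏_{i=0}^{k-1} (x - i)(x - i + 2)(x + 2i + 4)`. -/
noncomputable def muPoly (k : ℕ) (x : ℝ) : ℝ :=
  ∏ i ∈ Finset.range k, (x - (i : ℝ)) * (x - (i : ℝ) + 2) * (x + 2 * (i : ℝ) + 4)

open Equiv

section Colorings

variable {m : ℕ}

/-- Colorings of the points with `n` colors that are constant on the orbits of `⟨M, N⟩` are the
colorings invariant under `M` and `N`; there are `n ^ numOrbits M N` of them. -/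
theorem card_invariant_colorings (M N : Perm (Fin m)) (n : ℕ) :
    Nat.card {l : Fin m → Fin n // (∀ p, l (M p) = l p) ∧ ∀ p, l (N p) = l p} =
      n ^ numOrbits M N := by
  have key : ∀ l : Fin m → Fin n, ((∀ p, l (M p) = l p) ∧ ∀ p, l (N p) = l p) →
      ∀ g ∈ Subgroup.closure {M, N}, ∀ p, l (g p) = l p := by
    rintro l ⟨hM, hN⟩ g hg
    induction hg using Subgroup.closure_induction with
    | mem g hg =>
      rcases hg with rfl | rfl
      · exact hM
      · exact hN
    | one => simp
    | mul g h _ _ hg hh => intro p; rw [Perm.mul_apply, hg, hh]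
    | inv g _ hg => intro p; rw [← hg (g⁻¹ p)]; simp
  let e : {l : Fin m → Fin n // (∀ p, l (M p) = l p) ∧ ∀ p, l (N p) = l p} ≃
      (MulAction.orbitRel.Quotient (Subgroup.closure {M, N}) (Fin m) → Fin n) :=
    { toFun := fun l => Quotient.lift l.1 (by
        rintro p q ⟨g, rfl⟩
        exact key l.1 l.2 g.1 g.2 q)
      invFun := fun f => ⟨fun p => f (Quotient.mk _ p),
        fun p => congrArg f (Quotient.sound
          ⟨⟨M, Subgroup.subset_closure (by simp)⟩, rfl⟩),
        fun p => congrArg f (Quotient.sound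
          ⟨⟨N, Subgroup.subset_closure (by simp)⟩, rfl⟩)⟩
      left_inv := fun l => rfl
      right_inv := fun f => by
        funext q
        induction q using Quotient.inductionOn with
        | h p => rfl }
  rw [Nat.card_congr e, Nat.card_fun, Nat.card_fin, numOrbits]

theorem numOrbits_conj (g M N : Perm (Fin m)) :
    numOrbits (g * M * g⁻¹) (g * N * g⁻¹) = numOrbits M N := by
  apply Nat.pow_right_injective le_rfl
  change 2 ^ _ = 2 ^ _
  rw [← card_invariant_colorings, ← card_invariant_colorings]
  refine Nat.card_congr ((Equiv.arrowCongr g.symm (Equiv.refl (Fin 2))).subtypeEquiv fun l => ?_)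
  simp only [arrowCongr_apply, Function.comp_apply, Perm.mul_apply, coe_refl, id]
  refine and_congr ⟨fun h p => ?_, fun h p => ?_⟩ ⟨fun h p => ?_, fun h p => ?_⟩
  · simpa using h (g p)
  · simpa using h (g⁻¹ p)
  · simpa using h (g p)
  · simpa using h (g⁻¹ p)

theorem IsPM.apply_apply {M : Perm (Fin m)} (hM : IsPM M) (p : Fin m) : M (M p) = p := by
  rw [← Perm.mul_apply, hM.1, Perm.one_apply]

theorem IsPM.conj {M : Perm (Fin m)} (hM : IsPM M) (g : Perm (Fin m)) : IsPM (g * M * g⁻¹) := by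
  refine ⟨?_, fun p h => hM.2 (g⁻¹ p) ?_⟩
  · rw [show g * M * g⁻¹ * (g * M * g⁻¹) = g * (M * M) * g⁻¹ by group, hM.1]
    simp
  · rw [Perm.mul_apply, Perm.mul_apply] at h
    rw [Perm.eq_inv_iff_eq, h]

/-- Rewiring `N` so that it contains an edge `{a, b}` of `M` splits off one more orbit. -/
theorem numOrbits_rewire {M N : Perm (Fin m)} (hN : IsPM N) {a b : Fin m} (hne : a ≠ b)
    (hab : M a = b) (hba : M b = a) (hNab : N a ≠ b) :
    numOrbits M (swap b (N a) * N * (swap b (N a))⁻¹) = numOrbits M N + 1 := by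
  set N' := swap b (N a) * N * (swap b (N a))⁻¹ with hN'
  have hNN := hN.apply_apply
  have hNba : N b ≠ a := fun h => hNab (by rw [← h, hNN])
  have hpq : N a ≠ N b := fun h => hne (N.injective h)
  have hpa := hN.2 a
  have hqb := hN.2 b
  have ha : N' a = b := by
    simp [hN', swap_apply_of_ne_of_ne hne hpa.symm]
  have hb : N' b = a := by
    simp [hN', hNN, swap_apply_of_ne_of_ne hne hpa.symm]
  have hp : N' (N a) = N b := by
    simp [hN', swap_apply_of_ne_of_ne hqb hpq.symm]
  have hq : N' (N b) = N a := by
    simp [hN', swap_apply_of_ne_of_ne hqb hpq.symm, hNN]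
  have hz : ∀ z, z ≠ a → z ≠ b → z ≠ N a → z ≠ N b → N' z = N z := by
    intro z h1 h2 h3 h4
    have h5 : N z ≠ b := fun h => h4 (by rw [← h, hNN])
    have h6 : N z ≠ N a := fun h => h1 (N.injective h)
    simp [hN', swap_apply_of_ne_of_ne h2 h3, swap_apply_of_ne_of_ne h5 h6]
  have hM : ∀ z, (M z = a ∨ M z = b) ↔ (z = a ∨ z = b) := by
    intro z
    have h1 : M z = a ↔ z = b := by rw [← M.injective.eq_iff (b := b), hba]
    have h2 : M z = b ↔ z = a := by rw [← M.injective.eq_iff (b := a), hab]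
    rw [h1, h2, or_comm]
  have hMrec : ∀ (l : Fin m → Fin 2) (c : Fin 2), (∀ p, l (M p) = l p) → ∀ p,
      (if M p = a ∨ M p = b then c else l (M p)) = if p = a ∨ p = b then c else l p := by
    intro l c h p
    simp only [hM, h]
  let e : {l : Fin m → Fin 2 // (∀ p, l (M p) = l p) ∧ ∀ p, l (N' p) = l p} ≃
      {l : Fin m → Fin 2 // (∀ p, l (M p) = l p) ∧ ∀ p, l (N p) = l p} × Fin 2 :=
    { toFun := fun l => (⟨fun z => if z = a ∨ z = b then l.1 (N a) else l.1 z,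
        hMrec _ _ l.2.1, fun z => by
          have hl := l.2.2
          have hlq : l.1 (N b) = l.1 (N a) := by rw [← hp, hl]
          by_cases h1 : z = a
          · subst h1; simp [hpa, hNab]
          by_cases h2 : z = b
          · subst h2; simp [hNba, hqb, hlq]
          by_cases h3 : z = N a
          · subst h3; simp [hNN, hpa, hNab]
          by_cases h4 : z = N b
          · subst h4; simp [hNN, hNba, hqb, hlq]
          have h5 : N z ≠ a := fun h => h3 (by rw [← h, hNN])
          have h6 : N z ≠ b := fun h => h4 (by rw [← h, hNN])
          simp only [h1, h2, h5, h6, or_self, if_false]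
          rw [← hz z h1 h2 h3 h4, hl]⟩, l.1 a)
      invFun := fun x => ⟨fun z => if z = a ∨ z = b then x.2 else x.1.1 z,
        hMrec _ _ x.1.2.1, fun z => by
          have hl := x.1.2.2
          have hlab : x.1.1 b = x.1.1 a := by rw [← hab, x.1.2.1]
          by_cases h1 : z = a
          · subst h1; simp [ha]
          by_cases h2 : z = b
          · subst h2; simp [hb]
          by_cases h3 : z = N a
          · subst h3; simp [hp, hNba, hqb, hpa, hNab, hl, hlab]
          by_cases h4 : z = N b
          · subst h4; simp [hq, hNba, hqb, hpa, hNab, hl, hlab]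
          have h5 : N z ≠ a := fun h => h3 (by rw [← h, hNN])
          have h6 : N z ≠ b := fun h => h4 (by rw [← h, hNN])
          simp [h1, h2, h5, h6, hz z h1 h2 h3 h4, hl]⟩
      left_inv := fun l => by
        have hlab : l.1 b = l.1 a := by rw [← hab, l.2.1]
        ext z : 2
        by_cases h1 : z = a
        · simp [h1]
        by_cases h2 : z = b
        · simp [h2, hlab]
        simp [h1, h2]
      right_inv := fun x => by
        have hl := x.1.2.2
        have hlab : x.1.1 b = x.1.1 a := by rw [← hab, x.1.2.1]
        refine Prod.ext (Subtype.ext (funext fun z => ?_)) ?_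
        · by_cases h1 : z = a
          · simp [h1, hpa, hNab, hl]
          by_cases h2 : z = b
          · simp [h2, hpa, hNab, hl, hlab]
          simp [h1, h2]
        · simp }
  apply Nat.pow_right_injective le_rfl
  change 2 ^ _ = 2 ^ _
  rw [pow_succ, ← card_invariant_colorings, ← card_invariant_colorings, Nat.card_congr e,
    Nat.card_prod, Nat.card_fin]

end Colorings

section Involutions

/-- Any two fixed-point-free involutions of a finite type are conjugate. -/
theorem isConj_of_involutive {α : Type*} [Fintype α] [DecidableEq α] {f g : Perm α}
    (hf : ∀ p, f (f p) = p) (hg : ∀ p, g (g p) = p) (hf' : ∀ p, f p ≠ p) (hg' : ∀ p, g p ≠ p) :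
    IsConj f g := by
  have key : ∀ f : Perm α, (∀ p, f (f p) = p) → (∀ p, f p ≠ p) →
      f.cycleType = Multiset.replicate (Fintype.card α / 2) 2 := by
    intro f h h'
    have h2 : ∀ n ∈ f.cycleType, n = 2 := by
      intro n hn
      have h3 : f ^ 2 = 1 := by
        ext1 p
        simp [pow_two, h]
      exact le_antisymm (Nat.le_of_dvd two_pos
        ((Perm.dvd_of_mem_cycleType hn).trans (orderOf_dvd_of_pow_eq_one h3)))
        (Perm.two_le_of_mem_cycleType hn)
    have h4 := Multiset.eq_replicate_card.2 h2
    have h5 := f.sum_cycleType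
    have h6 : f.support = Finset.univ := by
      ext p
      simp [h']
    rw [h4, h6, Multiset.sum_replicate, Finset.card_univ, smul_eq_mul] at h5
    rw [h4, ← h5]
    simp
  exact Perm.isConj_iff_cycleType_eq.2 ((key f hf hf').trans (key g hg hg').symm)

end Involutions

section Roots

open Polynomial

/-- A polynomial of degree at most `n` vanishing at `1, …, n` is a multiple of `∏ (X - i)`. -/
theorem eval_eq_coeff_mul_prod (P : ℝ[X]) (n : ℕ) (hdeg : P.natDegree ≤ n)
    (hroot : ∀ i ∈ Finset.range n, P.eval ((i : ℝ) + 1) = 0) (x : ℝ) :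
    P.eval x = P.coeff n * ∏ i ∈ Finset.range n, (x - ((i : ℝ) + 1)) := by
  let R : ℝ[X] := ∏ i ∈ Finset.range n, (X - C ((i : ℝ) + 1))
  have hmonic : R.Monic := monic_prod_of_monic _ _ fun i _ => monic_X_sub_C _
  have hRdeg : R.natDegree = n := by
    rw [natDegree_prod_of_monic _ _ fun i _ => monic_X_sub_C _]
    simp only [natDegree_X_sub_C, Finset.sum_const, Finset.card_range, smul_eq_mul, mul_one]
  have hPR : P = C (P.coeff n) * R := by
    have hinj : Set.InjOn (fun i : ℕ => (i : ℝ) + 1) (Finset.range n) := fun i _ j _ h => by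
      simpa using h
    refine eq_of_degree_sub_lt_of_eval_index_eq (Finset.range n) hinj ?_ fun i hi => ?_
    · rw [Finset.card_range, degree_lt_iff_coeff_zero]
      intro r hr
      rcases hr.eq_or_lt with rfl | hr
      · have : R.coeff n = 1 := by rw [← hRdeg]; exact hmonic
        simp [this]
      · rw [coeff_sub, coeff_C_mul, coeff_eq_zero_of_natDegree_lt (hdeg.trans_lt hr),
          coeff_eq_zero_of_natDegree_lt (hRdeg.trans_lt hr)]
        simp
    · rw [hroot i hi, eval_mul, eval_prod, Finset.prod_eq_zero hi (by simp), mul_zero]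
  conv_lhs => rw [hPR]
  simp [R, eval_prod]

end Roots

/-- A labeling of `m` points by `Fin k` with two distinguished columns `a` and `b` of points
carrying each label exactly once; all points outside the columns are labelled `0`. -/
structure ColumnLabeling (m k : ℕ) [NeZero k] where
  /-- The first column. -/
  a : Fin k ↪ Fin m
  /-- The second column. -/
  b : Fin k ↪ Fin m
  /-- The label of a point. -/
  lab : Fin m → Fin k
  lab_a : ∀ i, lab (a i) = i
  lab_b : ∀ i, lab (b i) = i
  a_ne_b : ∀ i j, a i ≠ b j
  eq_of_lab : ∀ p, lab p ≠ 0 → p = a (lab p) ∨ p = b (lab p)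

namespace ColumnLabeling

open Finset

section Sign

variable {k : ℕ}

/-- The sign character of the column group. -/
noncomputable def sgn (k : ℕ) : Perm (Fin k) × Perm (Fin k) →* ℝ :=
  (Int.castRingHom ℝ : ℤ →* ℝ).comp
    ((Units.coeHom ℤ).comp (MonoidHom.coprod Perm.sign Perm.sign))

theorem sgn_mul_self (c : Perm (Fin k) × Perm (Fin k)) : sgn k c * sgn k c = 1 := by
  have h : ∀ u : ℤˣ, ((u : ℤ) : ℝ) * ((u : ℤ) : ℝ) = 1 := by
    intro u
    rcases Int.units_eq_one_or u with rfl | rfl <;> simp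
  exact h _

theorem sgn_inv (c : Perm (Fin k) × Perm (Fin k)) : sgn k c⁻¹ = sgn k c := by
  have h1 : sgn k c⁻¹ * sgn k c = 1 := by rw [← map_mul]; simp
  calc sgn k c⁻¹ = sgn k c⁻¹ * (sgn k c * sgn k c) := by rw [sgn_mul_self, mul_one]
    _ = sgn k c := by rw [← mul_assoc, h1, one_mul]

theorem sgn_swap_fst {i j : Fin k} (h : i ≠ j) : sgn k (swap i j, 1) = -1 := by
  simp [sgn, Perm.sign_swap h]

theorem sgn_swap_snd {i j : Fin k} (h : i ≠ j) : sgn k (1, swap i j) = -1 := by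
  simp [sgn, Perm.sign_swap h]

theorem sgn_diag (σ : Perm (Fin k)) : sgn k (σ, σ) = 1 := by
  have h : ∀ u : ℤˣ, (((u * u : ℤˣ) : ℤ) : ℝ) = 1 := by
    intro u
    rcases Int.units_eq_one_or u with rfl | rfl <;> simp
  exact h _

/-- If a function of column permutations changes sign under left multiplication by some fixed
element, its sum vanishes. -/
theorem sum_eq_zero_of_neg {F : Perm (Fin k) × Perm (Fin k) → ℝ}
    (t : Perm (Fin k) × Perm (Fin k)) (h : ∀ c, F (t * c) = -F c) : ∑ c, F c = 0 := by
  have h1 := Equiv.sum_comp (Equiv.mulLeft t) F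
  simp only [Equiv.coe_mulLeft, h, sum_neg_distrib] at h1
  linarith

end Sign

variable {m k : ℕ} [NeZero k] (S : ColumnLabeling m k)

theorem notMem_range_a (j : Fin k) : S.b j ∉ Set.range S.a := by
  rintro ⟨i, hi⟩
  exact S.a_ne_b i j hi

theorem notMem_range_b (j : Fin k) : S.a j ∉ Set.range S.b := by
  rintro ⟨i, hi⟩
  exact S.a_ne_b j i hi.symm

/-- The column group, permuting the points within each of the two columns. -/
noncomputable def col : Perm (Fin k) × Perm (Fin k) →* Perm (Fin m) :=
  MonoidHom.noncommCoprod (Perm.viaEmbeddingHom S.a) (Perm.viaEmbeddingHom S.b) fun σ τ => by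
    refine Perm.Disjoint.commute fun p => ?_
    by_cases hp : p ∈ Set.range S.a
    · obtain ⟨i, rfl⟩ := hp
      exact Or.inr (Perm.viaEmbedding_apply_of_notMem _ _ _ (S.notMem_range_b i))
    · exact Or.inl (Perm.viaEmbedding_apply_of_notMem _ _ _ hp)

theorem col_apply_a (c : Perm (Fin k) × Perm (Fin k)) (i : Fin k) :
    S.col c (S.a i) = S.a (c.1 i) := by
  rw [col, MonoidHom.noncommCoprod_apply, Perm.mul_apply, Perm.viaEmbeddingHom_apply,
    Perm.viaEmbeddingHom_apply, Perm.viaEmbedding_apply_of_notMem _ _ _ (S.notMem_range_b i),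
    Perm.viaEmbedding_apply]

theorem col_apply_b (c : Perm (Fin k) × Perm (Fin k)) (i : Fin k) :
    S.col c (S.b i) = S.b (c.2 i) := by
  rw [col, MonoidHom.noncommCoprod_apply, Perm.mul_apply, Perm.viaEmbeddingHom_apply,
    Perm.viaEmbeddingHom_apply, Perm.viaEmbedding_apply,
    Perm.viaEmbedding_apply_of_notMem _ _ _ (S.notMem_range_a _)]

theorem col_apply_of_notMem (c : Perm (Fin k) × Perm (Fin k)) {p : Fin m}
    (ha : p ∉ Set.range S.a) (hb : p ∉ Set.range S.b) : S.col c p = p := by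
  rw [col, MonoidHom.noncommCoprod_apply, Perm.mul_apply, Perm.viaEmbeddingHom_apply,
    Perm.viaEmbeddingHom_apply, Perm.viaEmbedding_apply_of_notMem _ _ _ hb,
    Perm.viaEmbedding_apply_of_notMem _ _ _ ha]

theorem lab_eq_zero {p : Fin m} (ha : p ∉ Set.range S.a) (hb : p ∉ Set.range S.b) :
    S.lab p = 0 := by
  by_contra h
  rcases S.eq_of_lab p h with h | h
  · exact ha ⟨_, h.symm⟩
  · exact hb ⟨_, h.symm⟩

theorem comp_col_swap_fst {α : Type*} (l : Fin m → α) {i j : Fin k}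
    (h : l (S.a i) = l (S.a j)) (p : Fin m) : l (S.col (swap i j, 1) p) = l p := by
  by_cases ha : p ∈ Set.range S.a
  · obtain ⟨r, rfl⟩ := ha
    rw [col_apply_a]
    change l (S.a (swap i j r)) = _
    by_cases hi : r = i
    · rw [hi, swap_apply_left, h]
    by_cases hj : r = j
    · rw [hj, swap_apply_right, h]
    rw [swap_apply_of_ne_of_ne hi hj]
  by_cases hb : p ∈ Set.range S.b
  · obtain ⟨r, rfl⟩ := hb
    rw [col_apply_b]
    rfl
  · rw [S.col_apply_of_notMem _ ha hb]

theorem comp_col_swap_snd {α : Type*} (l : Fin m → α) {i j : Fin k}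
    (h : l (S.b i) = l (S.b j)) (p : Fin m) : l (S.col (1, swap i j) p) = l p := by
  by_cases ha : p ∈ Set.range S.a
  · obtain ⟨r, rfl⟩ := ha
    rw [col_apply_a]
    rfl
  by_cases hb : p ∈ Set.range S.b
  · obtain ⟨r, rfl⟩ := hb
    rw [col_apply_b]
    change l (S.b (swap i j r)) = _
    by_cases hi : r = i
    · rw [hi, swap_apply_left, h]
    by_cases hj : r = j
    · rw [hj, swap_apply_right, h]
    rw [swap_apply_of_ne_of_ne hi hj]
  · rw [S.col_apply_of_notMem _ ha hb]

open Classical in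
/-- The perfect matchings all of whose edges join points with equal labels. -/
noncomputable def matchings : Finset (Perm (Fin m)) :=
  univ.filter fun M => IsPM M ∧ ∀ p, S.lab (M p) = S.lab p

theorem mem_matchings {M : Perm (Fin m)} :
    M ∈ S.matchings ↔ IsPM M ∧ ∀ p, S.lab (M p) = S.lab p := by
  simp [matchings]

theorem conj_mem_matchings {h M : Perm (Fin m)} (hh : ∀ p, S.lab (h p) = S.lab p)
    (hM : M ∈ S.matchings) : h * M * h⁻¹ ∈ S.matchings := by
  rw [mem_matchings] at hM ⊢
  refine ⟨hM.1.conj h, fun p => ?_⟩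
  rw [Perm.mul_apply, Perm.mul_apply, hh, hM.2, ← hh]
  simp

theorem sum_matchings_conj {h : Perm (Fin m)} (hh : ∀ p, S.lab (h p) = S.lab p)
    (f : Perm (Fin m) → ℝ) :
    ∑ M ∈ S.matchings, f (h * M * h⁻¹) = ∑ M ∈ S.matchings, f M := by
  have hh' : ∀ p, S.lab (h⁻¹ p) = S.lab p := fun p => by
    simpa using (hh (h⁻¹ p)).symm
  refine sum_nbij' (fun M => h * M * h⁻¹) (fun M => h⁻¹ * M * h)
    (fun M hM => S.conj_mem_matchings hh hM)
    (fun M hM => by simpa using S.conj_mem_matchings hh' hM) ?_ ?_ ?_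
  · intro M _; group
  · intro M _; group
  · intro M _; rfl

/-- The pairing of the sum of all label-preserving matchings with its translate by `g`. -/
noncomputable def pairing (x : ℝ) (g : Perm (Fin m)) : ℝ :=
  ∑ M ∈ S.matchings, ∑ N ∈ S.matchings, x ^ numOrbits M (g * N * g⁻¹)

theorem pairing_mul_left (x : ℝ) {h : Perm (Fin m)} (hh : ∀ p, S.lab (h p) = S.lab p)
    (g : Perm (Fin m)) : S.pairing x (h * g) = S.pairing x g := by
  rw [pairing, pairing, ← S.sum_matchings_conj hh]
  refine sum_congr rfl fun M _ => sum_congr rfl fun N _ => ?_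
  rw [show h * g * N * (h * g)⁻¹ = h * (g * N * g⁻¹) * h⁻¹ by group, numOrbits_conj]

/-- The pairing, antisymmetrized over the column group. -/
noncomputable def altPairing (x : ℝ) (g : Perm (Fin m)) : ℝ :=
  ∑ c, sgn k c * S.pairing x (g * S.col c)

theorem altPairing_mul_col (x : ℝ) (g : Perm (Fin m)) (c : Perm (Fin k) × Perm (Fin k)) :
    S.altPairing x (g * S.col c) = sgn k c * S.altPairing x g := by
  rw [altPairing, altPairing, ← Equiv.sum_comp (Equiv.mulLeft c) fun c' =>
    sgn k c' * S.pairing x (g * S.col c'), mul_sum]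
  refine sum_congr rfl fun c' _ => ?_
  rw [Equiv.coe_mulLeft, map_mul, map_mul, ← mul_assoc, ← mul_assoc, sgn_mul_self, one_mul,
    mul_assoc g]

theorem altPairing_congr (x : ℝ) {g g' : Perm (Fin m)} (h : ∀ p, S.lab (g p) = S.lab (g' p)) :
    S.altPairing x g = S.altPairing x g' := by
  refine sum_congr rfl fun c _ => ?_
  rw [← S.pairing_mul_left x (h := g * g'⁻¹) (fun p => by simp [h]) (g' * S.col c)]
  congr 2
  group

open Classical in
/-- The polytabloid: the signed sum of the images of the labeling under the column group. -/
noncomputable def polytabloid (l : Fin m → Fin k) : ℝ :=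
  ∑ c, if l = S.lab ∘ S.col c then sgn k c else 0

theorem lab_col_injective {c c' : Perm (Fin k) × Perm (Fin k)}
    (h : S.lab ∘ S.col c = S.lab ∘ S.col c') : c = c' := by
  refine Prod.ext (Equiv.ext fun i => ?_) (Equiv.ext fun i => ?_)
  · simpa [col_apply_a, lab_a] using congrFun h (S.a i)
  · simpa [col_apply_b, lab_b] using congrFun h (S.b i)

theorem polytabloid_col (c : Perm (Fin k) × Perm (Fin k)) :
    S.polytabloid (S.lab ∘ S.col c) = sgn k c := by
  rw [polytabloid, sum_eq_single c]
  · simp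
  · intro c' _ hne
    rw [if_neg fun h => hne (S.lab_col_injective h).symm]
  · simp

theorem polytabloid_eq_zero {l : Fin m → Fin k} (h : ∀ c, l ≠ S.lab ∘ S.col c) :
    S.polytabloid l = 0 :=
  sum_eq_zero fun c _ => if_neg (h c)

/-- A permuted labeling that is injective on both columns comes from a column permutation. -/
theorem exists_col_of_injective {g : Perm (Fin m)}
    (ha : Function.Injective fun i => S.lab (g (S.a i)))
    (hb : Function.Injective fun i => S.lab (g (S.b i))) :
    ∃ c, ∀ p, S.lab (g p) = S.lab (S.col c p) := by
  have ha' := Finite.injective_iff_bijective.1 ha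
  have hb' := Finite.injective_iff_bijective.1 hb
  refine ⟨(Equiv.ofBijective _ ha', Equiv.ofBijective _ hb'), fun p => ?_⟩
  by_cases hpa : p ∈ Set.range S.a
  · obtain ⟨i, rfl⟩ := hpa
    simp [col_apply_a, lab_a]
  by_cases hpb : p ∈ Set.range S.b
  · obtain ⟨i, rfl⟩ := hpb
    simp [col_apply_b, lab_b]
  rw [S.col_apply_of_notMem _ hpa hpb, S.lab_eq_zero hpa hpb]
  by_contra h0
  obtain ⟨i, hi⟩ := ha'.2 (S.lab (g p))
  obtain ⟨j, hj⟩ := hb'.2 (S.lab (g p))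
  simp only at hi hj
  have hpi : p ≠ S.a i := fun h => hpa ⟨i, h.symm⟩
  have hpj : p ≠ S.b j := fun h => hpb ⟨j, h.symm⟩
  have h1 := S.eq_of_lab _ h0
  have h2 := S.eq_of_lab (g (S.a i)) (hi ▸ h0)
  have h3 := S.eq_of_lab (g (S.b j)) (hj ▸ h0)
  rw [hi] at h2
  rw [hj] at h3
  have e1 : g p ≠ g (S.a i) := fun h => hpi (g.injective h)
  have e2 : g p ≠ g (S.b j) := fun h => hpj (g.injective h)
  have e3 : g (S.a i) ≠ g (S.b j) := fun h => S.a_ne_b i j (g.injective h)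
  grind

theorem altPairing_eq (x : ℝ) (g : Perm (Fin m)) :
    S.altPairing x g = S.polytabloid (S.lab ∘ g) * S.altPairing x 1 := by
  by_cases h : ∃ c, ∀ p, S.lab (g p) = S.lab (S.col c p)
  · obtain ⟨c, hc⟩ := h
    rw [show S.lab ∘ g = S.lab ∘ S.col c from funext hc, polytabloid_col,
      S.altPairing_congr x hc, ← altPairing_mul_col, one_mul]
  · rw [S.polytabloid_eq_zero (l := S.lab ∘ g) fun c hc => h ⟨c, congrFun hc⟩, zero_mul]
    have key : ∀ t, sgn k t = -1 → (∀ p, S.lab (g (S.col t p)) = S.lab (g p)) →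
        S.altPairing x g = 0 := by
      intro t ht hl
      have h1 := S.altPairing_mul_col x g t
      rw [S.altPairing_congr x (g := g * S.col t) (g' := g) hl, ht] at h1
      linarith
    by_cases ha : Function.Injective fun i => S.lab (g (S.a i))
    · by_cases hb : Function.Injective fun i => S.lab (g (S.b i))
      · exact absurd (S.exists_col_of_injective ha hb) h
      · obtain ⟨i, j, hij, hne⟩ := Function.not_injective_iff.1 hb
        exact key _ (sgn_swap_snd hne) (S.comp_col_swap_snd (fun p => S.lab (g p)) hij)
    · obtain ⟨i, j, hij, hne⟩ := Function.not_injective_iff.1 ha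
      exact key _ (sgn_swap_fst hne) (S.comp_col_swap_fst (fun p => S.lab (g p)) hij)

theorem sum_polytabloid_mul (f : (Fin m → Fin k) → ℝ) :
    ∑ l, S.polytabloid l * f l = ∑ c, sgn k c * f (S.lab ∘ S.col c) := by
  simp only [polytabloid, sum_mul, ite_mul, zero_mul]
  rw [sum_comm]
  refine sum_congr rfl fun c _ => ?_
  simp

theorem sum_sgn_pairing (x : ℝ) (q : Perm (Fin m)) :
    ∑ c, ∑ c', sgn k c * sgn k c' * S.pairing x ((S.col c)⁻¹ * q * S.col c') =
      S.altPairing x 1 * ∑ l, S.polytabloid l * S.polytabloid (l ∘ q) := by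
  rw [S.sum_polytabloid_mul fun l => S.polytabloid (l ∘ q), mul_sum,
    ← Equiv.sum_comp (Equiv.inv _)]
  refine sum_congr rfl fun c _ => ?_
  simp only [Equiv.inv_apply, sgn_inv]
  simp only [mul_assoc, ← mul_sum, map_inv, inv_inv]
  have := S.altPairing_eq x (S.col c * q)
  rw [altPairing] at this
  simp only [mul_assoc] at this
  rw [this, Perm.coe_mul, Function.comp_assoc]
  ring

theorem mem_matchings_iff {N : Perm (Fin m)} :
    N ∈ S.matchings ↔ IsPM N ∧ ∀ i, i ≠ 0 → N (S.a i) = S.b i := by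
  rw [mem_matchings]
  refine and_congr_right fun hN => ⟨fun h i hi => ?_, fun h => ?_⟩
  · have h1 : S.lab (N (S.a i)) = i := by rw [h, lab_a]
    rcases S.eq_of_lab (N (S.a i)) (h1.symm ▸ hi) with h2 | h2
    · rw [h1] at h2
      exact absurd h2 (hN.2 _)
    · rwa [h1] at h2
  · have h' : ∀ i, i ≠ 0 → N (S.b i) = S.a i := fun i hi => by rw [← h i hi, hN.apply_apply]
    have key : ∀ p, S.lab p ≠ 0 → S.lab (N p) = S.lab p := by
      intro p hp
      rcases S.eq_of_lab p hp with h2 | h2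
      · rw [h2, h _ hp, lab_b, lab_a]
      · rw [h2, h' _ hp, lab_b, lab_a]
    intro p
    by_cases hp : S.lab p = 0
    · by_contra hne
      have h1 := key (N p) (by rwa [← hp])
      rw [hN.apply_apply] at h1
      exact hne h1.symm
    · exact key p hp

theorem matchings_apply_b {N : Perm (Fin m)} (hN : N ∈ S.matchings) {i : Fin k} (hi : i ≠ 0) :
    N (S.b i) = S.a i := by
  rw [mem_matchings_iff] at hN
  rw [← hN.2 i hi, hN.1.apply_apply]

open Classical in
/-- The labels `i ≠ 0` for which `{a i, b i}` is not an edge of `N`. -/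
noncomputable def defects (N : Perm (Fin m)) : Finset (Fin k) :=
  univ.filter fun i => i ≠ 0 ∧ N (S.a i) ≠ S.b i

theorem mem_defects {N : Perm (Fin m)} {i : Fin k} :
    i ∈ S.defects N ↔ i ≠ 0 ∧ N (S.a i) ≠ S.b i := by
  simp [defects]

theorem card_defects_le (N : Perm (Fin m)) : #(S.defects N) ≤ k - 1 := by
  have h : S.defects N ⊆ univ.erase 0 := fun i hi => by
    simpa using (S.mem_defects.1 hi).1
  simpa using card_le_card h

theorem mem_matchings_of_defects_eq_empty {N : Perm (Fin m)} (hN : IsPM N)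
    (h : S.defects N = ∅) : N ∈ S.matchings := by
  refine S.mem_matchings_iff.2 ⟨hN, fun i hi => ?_⟩
  by_contra hne
  have := S.mem_defects.2 ⟨hi, hne⟩
  simp [h] at this

theorem defects_rewire {N : Perm (Fin m)} (hN : IsPM N) {i : Fin k} (hi : i ∈ S.defects N) :
    S.defects (swap (S.b i) (N (S.a i)) * N * (swap (S.b i) (N (S.a i)))⁻¹) ⊂ S.defects N := by
  have hi' := S.mem_defects.1 hi
  rw [ssubset_iff_of_subset]
  · refine ⟨i, hi, fun h => (S.mem_defects.1 h).2 ?_⟩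
    simp [swap_apply_of_ne_of_ne (S.a_ne_b i i) (hN.2 _).symm]
  · intro i' h
    rw [mem_defects] at h ⊢
    refine ⟨h.1, fun he => h.2 ?_⟩
    have hne : i' ≠ i := by
      rintro rfl
      exact hi'.2 he
    have h1 : S.a i' ≠ N (S.a i) := by
      intro h2
      rw [h2, hN.apply_apply] at he
      exact S.a_ne_b _ _ he
    have h2 : S.b i' ≠ S.b i := fun h => hne (S.b.injective h)
    have h3 : S.b i' ≠ N (S.a i) := by
      intro h3
      rw [← he] at h3
      exact hne (S.a.injective (N.injective h3))
    simp [swap_apply_of_ne_of_ne (S.a_ne_b i' i) h1, he, swap_apply_of_ne_of_ne h2 h3]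

/-- Any perfect matching can be rewired into a label-preserving one, splitting off the same
number of orbits relative to all label-preserving matchings. -/
theorem exists_rewiring (N : Perm (Fin m)) (hN : IsPM N) :
    ∃ j ≤ k - 1, (j = 0 ↔ N ∈ S.matchings) ∧ ∃ N' ∈ S.matchings,
      ∀ M ∈ S.matchings, numOrbits M N + j = numOrbits M N' := by
  suffices h : ∀ d (N : Perm (Fin m)), IsPM N → #(S.defects N) = d →
      ∃ j ≤ d, (j = 0 ↔ N ∈ S.matchings) ∧ ∃ N' ∈ S.matchings,
      ∀ M ∈ S.matchings, numOrbits M N + j = numOrbits M N' by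
    obtain ⟨j, hj, hjN⟩ := h _ N hN rfl
    exact ⟨j, hj.trans (S.card_defects_le N), hjN⟩
  intro d
  induction d using Nat.strong_induction_on with
  | _ d ih =>
    intro N hN hd
    rcases (S.defects N).eq_empty_or_nonempty with h0 | ⟨i, hi⟩
    · have hmem := S.mem_matchings_of_defects_eq_empty hN h0
      exact ⟨0, Nat.zero_le _, iff_of_true rfl hmem, N, hmem, fun _ _ => rfl⟩
    · have hlt := card_lt_card (S.defects_rewire hN hi)
      rw [hd] at hlt
      obtain ⟨j, hj, -, N', hN', hM⟩ := ih _ hlt _ (hN.conj _) rfl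
      have hi' := S.mem_defects.1 hi
      refine ⟨j + 1, by omega, iff_of_false (by omega) fun hmem =>
        hi'.2 ((S.mem_matchings_iff.1 hmem).2 i hi'.1), N', hN', fun M hMm => ?_⟩
      rw [← hM M hMm, numOrbits_rewire hN (S.a_ne_b i i)
        ((S.mem_matchings_iff.1 hMm).2 i hi'.1) (S.matchings_apply_b hMm hi'.1) hi'.2]
      ring

theorem exists_conj_of_mem {N N' : Perm (Fin m)} (hN : N ∈ S.matchings)
    (hN' : N' ∈ S.matchings) :
    ∃ h : Perm (Fin m), (∀ p, S.lab p ≠ 0 → h p = p) ∧ h * N * h⁻¹ = N' := by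
  have hl := (S.mem_matchings.1 hN).2
  have hl' := (S.mem_matchings.1 hN').2
  have hP := (S.mem_matchings.1 hN).1
  have hP' := (S.mem_matchings.1 hN').1
  have e : ∀ p, S.lab (N p) = 0 ↔ S.lab p = 0 := fun p => by rw [hl]
  have e' : ∀ p, S.lab (N' p) = 0 ↔ S.lab p = 0 := fun p => by rw [hl']
  obtain ⟨h, hh⟩ := isConj_iff.1 (isConj_of_involutive
    (f := N.subtypePerm (p := fun p => S.lab p = 0) e) (g := N'.subtypePerm e')
    (fun p => Subtype.ext (hP.apply_apply p.1)) (fun p => Subtype.ext (hP'.apply_apply p.1))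
    (fun p hp => hP.2 p.1 (congrArg Subtype.val hp))
    (fun p hp => hP'.2 p.1 (congrArg Subtype.val hp)))
  have h0 : ∀ p, S.lab p ≠ 0 → Perm.ofSubtype h p = p := fun p hp =>
    Perm.ofSubtype_apply_of_not_mem h hp
  refine ⟨Perm.ofSubtype h, h0, ?_⟩
  rw [mul_inv_eq_iff_eq_mul]
  ext1 p
  rw [Perm.mul_apply, Perm.mul_apply]
  by_cases hp : S.lab p = 0
  · have h1 := congrArg Subtype.val (Perm.congr_fun (mul_inv_eq_iff_eq_mul.1 hh) ⟨p, hp⟩)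
    simp only [Perm.mul_apply, Perm.subtypePerm_apply] at h1
    rw [Perm.ofSubtype_apply_of_mem h ((e p).2 hp), Perm.ofSubtype_apply_of_mem h hp]
    exact h1
  · rw [h0 p hp, h0 _ (by rwa [hl])]
    rcases S.eq_of_lab p hp with h2 | h2
    · rw [h2, (S.mem_matchings_iff.1 hN).2 _ hp, (S.mem_matchings_iff.1 hN').2 _ hp]
    · rw [h2, S.matchings_apply_b hN hp, S.matchings_apply_b hN' hp]

theorem lab_apply_of_fix {h : Perm (Fin m)} (hh : ∀ p, S.lab p ≠ 0 → h p = p) (p : Fin m) :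
    S.lab (h p) = S.lab p := by
  by_cases hp : S.lab p = 0
  · by_contra hne
    rw [h.injective (hh (h p) (by rwa [← hp]))] at hne
    exact hne rfl
  · rw [hh p hp]

theorem sum_pow_numOrbits_eq (x : ℝ) {N N' : Perm (Fin m)} (hN : N ∈ S.matchings)
    (hN' : N' ∈ S.matchings) :
    ∑ M ∈ S.matchings, x ^ numOrbits M N = ∑ M ∈ S.matchings, x ^ numOrbits M N' := by
  obtain ⟨h, hh, rfl⟩ := S.exists_conj_of_mem hN hN'
  rw [← S.sum_matchings_conj (S.lab_apply_of_fix hh) fun M => x ^ numOrbits M (h * N * h⁻¹)]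
  exact sum_congr rfl fun M _ => by rw [numOrbits_conj]

/-- At a number of colors `n < k` the antisymmetrized pairing vanishes: in any coloring some two
points of the first column receive equal colors. -/
theorem altPairing_natCast_eq_zero {n : ℕ} (hn : n < k) : S.altPairing n 1 = 0 := by
  classical
  have hcard : ∀ M N : Perm (Fin m), (n : ℝ) ^ numOrbits M N =
      ∑ l : Fin m → Fin n, if (∀ p, l (M p) = l p) ∧ ∀ p, l (N p) = l p then 1 else 0 := by
    intro M N
    rw [sum_boole, ← Fintype.card_subtype, ← Nat.card_eq_fintype_card, card_invariant_colorings]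
    simp
  simp only [altPairing, pairing, one_mul, mul_sum, hcard]
  rw [sum_comm]
  refine sum_eq_zero fun M _ => ?_
  rw [sum_comm]
  refine sum_eq_zero fun N _ => ?_
  rw [sum_comm]
  refine sum_eq_zero fun l _ => ?_
  obtain ⟨i, j, hij, hl⟩ := Fintype.exists_ne_map_eq_of_card_lt (fun i => l (S.a i)) (by simpa)
  have h1 := S.comp_col_swap_fst l hl
  have h2 : ∀ p, l ((S.col (swap i j, 1))⁻¹ p) = l p := fun p => by
    simpa using (h1 ((S.col (swap i j, 1))⁻¹ p)).symm
  refine sum_eq_zero_of_neg (swap i j, 1) fun c => ?_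
  rw [map_mul, sgn_swap_fst hij, map_mul, neg_one_mul, neg_mul]
  congr 3
  refine propext (and_congr_right fun _ => ⟨fun h p => ?_, fun h p => ?_⟩)
  · have := h (S.col (swap i j, 1) p)
    simpa [h1] using this
  · have := h ((S.col (swap i j, 1))⁻¹ p)
    simpa [h1, (show ∀ p, l ((S.col (swap i j, 1)).symm p) = l p from h2)] using this

theorem sgn_eq_one_of_mem {N : Perm (Fin m)} {c : Perm (Fin k) × Perm (Fin k)}
    (hN : N ∈ S.matchings) (hc : S.col c * N * (S.col c)⁻¹ ∈ S.matchings) : sgn k c = 1 := by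
  have h1 : ∀ i, i ≠ 0 → c.1 i = c.2 i := by
    intro i hi
    have h2 := (S.mem_matchings.1 hc).2 (S.col c (S.a i))
    rw [Perm.mul_apply, Perm.mul_apply, Perm.inv_eq_iff_eq.2 rfl] at h2
    simp only [(S.mem_matchings_iff.1 hN).2 i hi, col_apply_a,
      col_apply_b, lab_a, lab_b] at h2
    exact h2.symm
  have h2 : c.1 = c.2 := by
    ext1 i
    by_cases hi : i = 0
    · subst hi
      obtain ⟨j, hj⟩ := c.2.surjective (c.1 0)
      by_cases h0 : j = 0
      · rw [← hj, h0]
      · rw [← h1 j h0] at hj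
        exact absurd (c.1.injective hj) h0
    · exact h1 i hi
  rw [← sgn_diag c.1]
  congr 1
  exact Prod.ext rfl h2.symm

open Polynomial in
/-- The antisymmetrized pairing is, up to positive factors, a multiple of `∏ (x - i)`, the product
being over `0 < i < k`. -/
theorem exists_altPairing_mul_pow_eq {x : ℝ} (hx : 0 < x) (hne : S.matchings.Nonempty) :
    ∃ r : ℝ, 0 < r ∧ S.altPairing x 1 * x ^ (k - 1) =
      r * ∏ i ∈ range (k - 1), (x - ((i : ℝ) + 1)) := by
  classical
  obtain ⟨N₀, hN₀⟩ := hne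
  choose! j hjk hj0 N' hN' hM using S.exists_rewiring
  set K : Perm (Fin k) × Perm (Fin k) → Perm (Fin m) → Perm (Fin m) :=
    fun c N => S.col c * N * (S.col c)⁻¹
  have hK : ∀ c, ∀ N ∈ S.matchings, IsPM (K c N) := fun c N hN =>
    (S.mem_matchings.1 hN).1.conj _
  let P : Polynomial ℝ := ∑ c, ∑ N ∈ S.matchings, C (sgn k c) * X ^ (k - 1 - j (K c N))
  have hP : ∀ y : ℝ, S.altPairing y 1 * y ^ (k - 1) =
      (∑ M ∈ S.matchings, y ^ numOrbits M N₀) * P.eval y := by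
    intro y
    simp only [P, eval_finsetSum, eval_mul, eval_C, eval_pow, eval_X, mul_sum _ _ (∑ M ∈ _, _)]
    rw [altPairing, sum_mul]
    refine sum_congr rfl fun c _ => ?_
    rw [pairing, sum_comm, mul_sum, sum_mul]
    refine sum_congr rfl fun N hN => ?_
    rw [one_mul, ← S.sum_pow_numOrbits_eq y (hN' _ (hK c N hN)) hN₀, mul_left_comm, mul_assoc,
      sum_mul, sum_mul]
    congr 1
    refine sum_congr rfl fun M hMm => ?_
    rw [← hM _ (hK c N hN) M hMm, ← pow_add, ← pow_add]
    have := hjk _ (hK c N hN)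
    congr 1
    change numOrbits M (K c N) + (k - 1) =
      numOrbits M (K c N) + j (K c N) + (k - 1 - j (K c N))
    omega
  have hS : ∀ y : ℝ, 0 < y → 0 < ∑ M ∈ S.matchings, y ^ numOrbits M N₀ := fun y hy =>
    sum_pos (fun M _ => pow_pos hy _) ⟨N₀, hN₀⟩
  have hdeg : P.natDegree ≤ k - 1 := by
    refine natDegree_sum_le_of_forall_le _ _ fun c _ => natDegree_sum_le_of_forall_le _ _
      fun N _ => (natDegree_C_mul_X_pow_le _ _).trans (Nat.sub_le _ _)
  have hlead : 0 < P.coeff (k - 1) := by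
    have h1 : P.coeff (k - 1) = ∑ c, ∑ N ∈ S.matchings, if j (K c N) = 0 then (1 : ℝ) else 0 := by
      simp only [P, finsetSum_coeff, coeff_C_mul, coeff_X_pow]
      refine sum_congr rfl fun c _ => sum_congr rfl fun N hN => ?_
      have h2 := hjk _ (hK c N hN)
      by_cases h0 : j (K c N) = 0
      · rw [if_pos (by omega), if_pos h0, mul_one,
          S.sgn_eq_one_of_mem hN ((hj0 _ (hK c N hN)).1 h0)]
      · rw [if_neg (by omega), if_neg h0, mul_zero]
    rw [h1]
    have h3 : ∀ c N, 0 ≤ if j (K c N) = 0 then (1 : ℝ) else 0 := fun c N => by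
      split_ifs <;> norm_num
    refine sum_pos' (fun c _ => sum_nonneg fun N _ => h3 c N) ⟨1, mem_univ _, ?_⟩
    refine sum_pos' (fun N _ => h3 1 N) ⟨N₀, hN₀, ?_⟩
    rw [if_pos ((hj0 _ (hK 1 N₀ hN₀)).2 (by simpa [K] using hN₀))]
    exact one_pos
  have hroot : ∀ i ∈ range (k - 1), P.eval ((i : ℝ) + 1) = 0 := by
    intro i hi
    have h1 := hP ((i + 1 : ℕ) : ℝ)
    rw [S.altPairing_natCast_eq_zero (by have := mem_range.1 hi; omega), zero_mul] at h1
    have h2 := hS ((i + 1 : ℕ) : ℝ) (by positivity)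
    simpa using (mul_eq_zero.1 h1.symm).resolve_left h2.ne'
  have hprod := eval_eq_coeff_mul_prod P (k - 1) hdeg hroot x
  refine ⟨(∑ M ∈ S.matchings, x ^ numOrbits M N₀) * P.coeff (k - 1),
    mul_pos (hS x hx) hlead, ?_⟩
  rw [hP, hprod, mul_assoc]

/-- The antisymmetrized pairing is negative just below `k - 1`. -/
theorem altPairing_one_neg {x : ℝ} (hx : 0 < x) (hxk : (k : ℝ) - 2 < x) (hxk' : x < (k : ℝ) - 1)
    (hne : S.matchings.Nonempty) : S.altPairing x 1 < 0 := by
  obtain ⟨r, hr, h⟩ := S.exists_altPairing_mul_pow_eq hx hne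
  obtain ⟨n, rfl⟩ : ∃ n, k = n + 2 := by
    refine ⟨k - 2, ?_⟩
    have : (1 : ℝ) < k := by linarith
    have : 1 < k := by exact_mod_cast this
    omega
  push_cast at hxk hxk'
  rw [show n + 2 - 1 = n + 1 by omega, prod_range_succ] at h
  have h1 : 0 < ∏ i ∈ range n, (x - ((i : ℝ) + 1)) := by
    refine prod_pos fun i hi => ?_
    have : (i : ℝ) + 1 ≤ n := by exact_mod_cast mem_range.1 hi
    linarith
  have h2 : x - ((n : ℝ) + 1) < 0 := by linarith
  by_contra hneg
  push Not at hneg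
  have h3 := mul_nonneg hneg (pow_nonneg hx.le (n + 1))
  have h4 := mul_pos hr (mul_pos_of_neg_of_neg (neg_neg_of_pos h1) h2)
  nlinarith

theorem sum_polytabloid_comp_pos {Q : Finset (Perm (Fin m))} (h1 : 1 ∈ Q)
    (hmul : ∀ q ∈ Q, ∀ q' ∈ Q, q * q' ∈ Q) (hnn : ∀ q ∈ Q, 0 ≤ S.polytabloid (S.lab ∘ q)) :
    0 < ∑ q ∈ Q, ∑ l, S.polytabloid l * S.polytabloid (l ∘ q) := by
  set f : (Fin m → Fin k) → ℝ := fun l => ∑ q ∈ Q, S.polytabloid (l ∘ q)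
  have hinv : ∀ q ∈ Q, ∀ l, ∑ q' ∈ Q, S.polytabloid (l ∘ q ∘ q') = f l := by
    intro q hq l
    have himg : Q.map (mulLeftEmbedding q) = Q :=
      eq_of_subset_of_card_le (fun r hr => by
        obtain ⟨q', hq', rfl⟩ := mem_map.1 hr
        exact hmul q hq q' hq') (card_map _).ge
    have h2 := sum_map Q (mulLeftEmbedding q) fun q' => S.polytabloid (l ∘ q')
    rw [himg] at h2
    exact h2.symm
  have hsum : ∑ q ∈ Q, ∑ l, S.polytabloid l * S.polytabloid (l ∘ q) =
      ∑ l, S.polytabloid l * f l := by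
    rw [sum_comm]
    simp only [f, mul_sum]
  have hshift : ∀ q ∈ Q, ∑ l, S.polytabloid l * f l = ∑ l, S.polytabloid (l ∘ q) * f l := by
    intro q hq
    rw [← Equiv.sum_comp (Equiv.arrowCongr q.symm (Equiv.refl (Fin k)))]
    refine sum_congr rfl fun l _ => ?_
    have h2 : (Equiv.arrowCongr q.symm (Equiv.refl (Fin k))) l = l ∘ q := rfl
    rw [h2, ← hinv q hq l]
    rfl
  have hsq : #Q * ∑ l, S.polytabloid l * f l = ∑ l, f l * f l := by
    rw [← nsmul_eq_mul, ← sum_const, sum_congr rfl hshift, sum_comm]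
    simp only [f, sum_mul]
  have hlab : 0 < f S.lab := by
    refine sum_pos' hnn ⟨1, h1, ?_⟩
    have h2 := S.polytabloid_col 1
    rw [map_one, map_one] at h2
    rw [h2]
    exact one_pos
  rw [hsum]
  have hpos : 0 < ∑ l, f l * f l :=
    sum_pos' (fun l _ => mul_self_nonneg _) ⟨S.lab, mem_univ _, mul_pos hlab hlab⟩
  rw [← hsq] at hpos
  exact pos_of_mul_pos_right hpos (Nat.cast_nonneg _)

/-- The value of the `Q`-averaged quadratic form at the antisymmetrization of the sum of all
label-preserving matchings. -/
theorem sum_form_eq (x : ℝ) (Q : Finset (Perm (Fin m))) :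
    ∑ u : (Perm (Fin k) × Perm (Fin k)) × S.matchings,
      ∑ v : (Perm (Fin k) × Perm (Fin k)) × S.matchings, sgn k u.1 * sgn k v.1 *
        ∑ q ∈ Q, x ^ numOrbits (S.col u.1 * u.2.1 * (S.col u.1)⁻¹)
          (q * (S.col v.1 * v.2.1 * (S.col v.1)⁻¹) * q⁻¹) =
      S.altPairing x 1 * ∑ q ∈ Q, ∑ l, S.polytabloid l * S.polytabloid (l ∘ q) := by
  rw [mul_sum]
  simp only [← S.sum_sgn_pairing, pairing, mul_sum]
  have hconj : ∀ (c c' q M N : Perm (Fin m)),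
      numOrbits (c * M * c⁻¹) (q * (c' * N * c'⁻¹) * q⁻¹) =
        numOrbits M (c⁻¹ * q * c' * N * (c⁻¹ * q * c')⁻¹) := by
    intro c c' q M N
    rw [← numOrbits_conj c M]
    congr 1
    group
  simp only [hconj]
  rw [Fintype.sum_prod_type, sum_comm (s := Q)]
  refine sum_congr rfl fun c _ => ?_
  refine (sum_congr rfl fun M _ => Fintype.sum_prod_type _).trans (sum_comm.trans ?_)
  rw [sum_comm (s := Q)]
  refine sum_congr rfl fun c' _ => ?_
  rw [sum_comm (s := Q), ← sum_coe_sort S.matchings]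
  refine sum_congr rfl fun M _ => ?_
  rw [sum_comm (s := Q), ← sum_coe_sort S.matchings]

end ColumnLabeling

section Blocks

variable {k : ℕ}

theorem blk_injective {j j' : Fin (2 * k)} {i i' : Fin 3} (h : blk j i = blk j' i') :
    j = j' ∧ i = i' := by
  have h1 := congrArg Fin.val h
  simp only [blk] at h1
  have := i.isLt
  have := i'.isLt
  exact ⟨Fin.ext (by omega), Fin.ext (by omega)⟩

theorem one_mem_Qset : (1 : Perm (Fin (6 * k))) ∈ Qset k :=
  ⟨1, fun _ => ⟨0, fun _ => by simp⟩, 1, ⟨1, fun _ _ => rfl⟩, by simp⟩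

theorem mul_mem_Qset {q q' : Perm (Fin (6 * k))} (hq : q ∈ Qset k) (hq' : q' ∈ Qset k) :
    q * q' ∈ Qset k := by
  obtain ⟨b, hb, d, ⟨π, hd⟩, rfl⟩ := hq
  obtain ⟨b', hb', d', ⟨π', hd'⟩, rfl⟩ := hq'
  refine ⟨b * (d * b' * d⁻¹), fun j => ?_, d * d', ⟨π * π', fun j i => ?_⟩, by group⟩
  · obtain ⟨s, hs⟩ := hb j
    obtain ⟨s', hs'⟩ := hb' (π⁻¹ j)
    refine ⟨s' + s, fun i => ?_⟩
    have h1 : ∀ i, d (blk (π⁻¹ j) i) = blk j i := fun i => by rw [hd]; simp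
    have h2 : d⁻¹ (blk j i) = blk (π⁻¹ j) i := by rw [Perm.inv_eq_iff_eq, h1]
    rw [Perm.mul_apply, Perm.mul_apply, Perm.mul_apply, h2, hs', h1, hs, add_assoc]
  · rw [Perm.mul_apply, hd', hd, Perm.mul_apply]

theorem exists_apply_blk_of_mem_Qset {q : Perm (Fin (6 * k))} (hq : q ∈ Qset k)
    (j : Fin (2 * k)) : ∃ j' s, ∀ i, q (blk j i) = blk j' (i + s) := by
  obtain ⟨b, hb, d, ⟨π, hd⟩, rfl⟩ := hq
  obtain ⟨s, hs⟩ := hb (π j)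
  exact ⟨π j, s, fun i => by rw [Perm.mul_apply, hd, hs]⟩

variable (k)

variable [NeZero k]

/-- The label of a point: the index of its block for the first two points of each of the first `k`
blocks, and `0` for all other points. -/
def blockLabel (p : Fin (6 * k)) : Fin k :=
  if h : p.1 / 3 < k ∧ p.1 % 3 < 2 then ⟨p.1 / 3, h.1⟩ else 0

theorem val_blockLabel (p : Fin (6 * k)) :
    (blockLabel k p).1 = if p.1 / 3 < k ∧ p.1 % 3 < 2 then p.1 / 3 else 0 := by
  unfold blockLabel
  split_ifs <;> rfl

theorem val_blockLabel_blk (j : Fin (2 * k)) (i : Fin 3) :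
    (blockLabel k (blk j i)).1 = if j.1 < k ∧ i.1 < 2 then j.1 else 0 := by
  have := i.isLt
  have h1 : (3 * j.1 + i.1) / 3 = j.1 := by omega
  have h2 : (3 * j.1 + i.1) % 3 = i.1 := by omega
  rw [val_blockLabel]
  simp only [blk, h1, h2]

/-- The labeling of `Fin (6 * k)` whose columns consist of the first and of the second points of
the first `k` blocks. -/
def blockLabeling : ColumnLabeling (6 * k) k where
  a := ⟨fun i => blk ⟨i, by omega⟩ 0, fun i j h => by simpa [Fin.ext_iff] using (blk_injective h).1⟩
  b := ⟨fun i => blk ⟨i, by omega⟩ 1, fun i j h => by simpa [Fin.ext_iff] using (blk_injective h).1⟩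
  lab := blockLabel k
  lab_a := fun i => Fin.ext ((val_blockLabel_blk k _ _).trans (by simp))
  lab_b := fun i => Fin.ext ((val_blockLabel_blk k _ _).trans (by simp))
  a_ne_b := fun i j h => by simpa using (blk_injective h).2
  eq_of_lab := fun p hp => by
    have h1 := val_blockLabel k p
    have h2 : (blockLabel k p).1 ≠ 0 := Fin.val_ne_zero_iff.2 hp
    refine (or_congr Fin.ext_iff Fin.ext_iff).2 ?_
    change p.1 = 3 * (blockLabel k p).1 + 0 ∨ p.1 = 3 * (blockLabel k p).1 + 1
    split_ifs at h1 <;> omega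

theorem blockLabeling_matchings_nonempty : (blockLabeling k).matchings.Nonempty := by
  have hinv : Function.Involutive fun p : Fin (6 * k) =>
      (⟨if p.1 % 3 = 0 then p.1 + 1 else if p.1 % 3 = 1 then p.1 - 1 else
        if p.1 < 3 * k then p.1 + 3 * k else p.1 - 3 * k, by split_ifs <;> omega⟩ :
        Fin (6 * k)) := by
    intro p
    ext
    dsimp only
    split_ifs <;> omega
  refine ⟨hinv.toPerm, (blockLabeling k).mem_matchings.2 ⟨⟨?_, fun p h => ?_⟩, fun p => ?_⟩⟩
  · ext1 p
    exact hinv p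
  · have h1 := congrArg Fin.val h
    simp only [Function.Involutive.coe_toPerm] at h1
    split_ifs at h1 <;> omega
  · ext
    simp only [Function.Involutive.coe_toPerm, blockLabeling, val_blockLabel]
    split_ifs <;> omega

theorem polytabloid_blockLabeling_nonneg {q : Perm (Fin (6 * k))} (hq : q ∈ Qset k) :
    0 ≤ (blockLabeling k).polytabloid ((blockLabeling k).lab ∘ q) := by
  set S := blockLabeling k
  by_cases h : ∃ c, S.lab ∘ q = S.lab ∘ S.col c
  · obtain ⟨c, hc⟩ := h
    have hcol : c.1 = c.2 := by
      ext1 i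
      have h0 := congrFun hc (S.a i)
      have h1 := congrFun hc (S.b i)
      have h2 := congrFun hc (blk ⟨i, by omega⟩ 2)
      simp only [Function.comp_apply] at h0 h1 h2
      rw [S.col_apply_a, S.lab_a] at h0
      rw [S.col_apply_b, S.lab_b] at h1
      rw [S.col_apply_of_notMem] at h2
      rotate_left
      · rintro ⟨j, hj⟩
        exact absurd (blk_injective hj).2 (by decide)
      · rintro ⟨j, hj⟩
        exact absurd (blk_injective hj).2 (by decide)
      obtain ⟨j, s, hs⟩ := exists_apply_blk_of_mem_Qset hq ⟨i, by omega⟩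
      rw [← h0, ← h1]
      change blockLabel k (q (blk _ 0)) = blockLabel k (q (blk _ 1))
      replace h2 := congrArg Fin.val h2
      change (blockLabel k _).1 = (blockLabel k _).1 at h2
      have h3 : (blockLabel k (blk ⟨i, by omega⟩ 2)).1 = 0 := by
        rw [val_blockLabel_blk]
        simp
      rw [h3, hs, val_blockLabel_blk] at h2
      rw [hs, hs]
      ext
      rw [val_blockLabel_blk, val_blockLabel_blk]
      fin_cases s <;> simp at h2 ⊢ <;> first | tauto | exact fun h => by simp [h2 h]
    rw [hc, S.polytabloid_col, show c = (c.1, c.1) from Prod.ext rfl hcol.symm,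
      ColumnLabeling.sgn_diag]
    exact zero_le_one
  · push Not at h
    rw [S.polytabloid_eq_zero h]

end Blocks

/-- The quadratic form of a positive semidefinite matrix is nonnegative on weighted finite families of
indices. -/
theorem Matrix.PosSemidef.sum_sum_mul_nonneg {n ι : Type*} [Fintype n] [Fintype ι]
    {A : Matrix n n ℝ} (hA : A.PosSemidef) (f : ι → n) (w : ι → ℝ) :
    0 ≤ ∑ u, ∑ v, w u * w v * A (f u) (f v) := by
  have h := (hA.submatrix f).dotProduct_mulVec_nonneg w
  simp only [dotProduct, Matrix.mulVec, Matrix.submatrix_apply, Finset.mul_sum, star_trivial] at h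
  refine h.trans_eq (Finset.sum_congr rfl fun u _ => Finset.sum_congr rfl fun v _ => ?_)
  ring

theorem not_posSemidef_AQ {k : ℕ} [NeZero k] {x : ℝ} (hx : 0 < x) (hxk : (k : ℝ) - 2 < x)
    (hxk' : x < (k : ℝ) - 1) : ¬ (AQ k x).PosSemidef := by
  intro hpsd
  set S := blockLabeling k
  have hneg := S.altPairing_one_neg hx hxk hxk' (blockLabeling_matchings_nonempty k)
  have hmem : ∀ q, q ∈ Qfin k ↔ q ∈ Qset k := fun q => Set.Finite.mem_toFinset _
  have hpos := S.sum_polytabloid_comp_pos (Q := Qfin k) ((hmem _).2 one_mem_Qset)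
    (fun q hq q' hq' => (hmem _).2 (mul_mem_Qset ((hmem _).1 hq) ((hmem _).1 hq')))
    fun q hq => polytabloid_blockLabeling_nonneg k ((hmem _).1 hq)
  have h := hpsd.sum_sum_mul_nonneg
    (fun u : (Perm (Fin k) × Perm (Fin k)) × S.matchings =>
      ⟨S.col u.1 * u.2.1 * (S.col u.1)⁻¹, (S.mem_matchings.1 u.2.2).1.conj _⟩)
    fun u => ColumnLabeling.sgn k u.1
  have h2 := S.sum_form_eq x (Qfin k)
  simp only [AQ, Matrix.of_apply] at h
  rw [h2] at h
  exact absurd h (not_le.2 (mul_neg_of_neg_of_pos hneg hpos))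

theorem stmt8 (x : ℝ) (hx : 0 ≤ x) (k : ℕ) (hk : (k : ℤ) = ⌈x⌉ + 1)
    (hpsd : (AQ k x).PosSemidef) :
    x = (k : ℝ) - 1 ∧ ∃ n : ℕ, x = (n : ℝ) := by
  have hkx : (k : ℝ) = ⌈x⌉ + 1 := by exact_mod_cast hk
  have hle := Int.le_ceil x
  have hlt := Int.ceil_lt_add_one x
  have hc := Int.ceil_nonneg hx
  obtain ⟨n, rfl⟩ : ∃ n, k = n + 1 := ⟨k - 1, by omega⟩
  have hxn : x = n := by
    push_cast at hkx
    by_contra hne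
    have hlt' : x < n := lt_of_le_of_ne (by linarith) hne
    have hx0 : 0 < x := by
      refine lt_of_le_of_ne hx ?_
      rintro rfl
      simp at hkx
      simp [hkx] at hlt'
    exact not_posSemidef_AQ hx0 (by push_cast; linarith) (by push_cast; linarith) hpsd
  exact ⟨by rw [hxn]; push_cast; ring, n, hxn⟩
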